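/- Suppose the cycle weights satisfy one of: α_j → α > 0 with ∑_j |α_j − α| < ∞; α_j → α ≤ 0 with ∑_j j^{−1}|α_j − α| < ∞; or α_j = γ log j with γ > 0. If ρ ≤ ρ_c, then under the Fourier-mode measure, in the thermodynamic limit |Λ|, N → ∞ with ρ = N/|Λ| fixed, Prob(n_0/N > δ) → 0 for every δ > 0. -/

import Mathlib

open MeasureTheory Filter Topology ENNReal
open scoped Classical

noncomputable section

/-- `r_j(π)`: the number of cycles of length `j` in `π ∈ S_n`
(fixed points count as cycles of length 1). -/
def cycCount {n : ℕ} (π : Equiv.Perm (Fin n)) (j : ℕ) : ℕ :=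
  if j = 1 then n - π.cycleType.sum else Multiset.count j π.cycleType

/-- The cycle weight `exp(-∑_{j≥1} α_j r_j(π))` of a permutation `π ∈ S_n`. -/
def permWeight (α : ℕ → ℝ) {n : ℕ} (π : Equiv.Perm (Fin n)) : ℝ :=
  Real.exp (-∑ j ∈ Finset.Icc 1 n, α j * (cycCount π j : ℝ))

/-- `h_n = (n!)⁻¹ ∑_{π ∈ S_n} e^{-∑_{j≥1} α_j r_j(π)}`, with `h_0 = 1`. -/
def hcoef (α : ℕ → ℝ) (n : ℕ) : ℝ :=
  (n.factorial : ℝ)⁻¹ * ∑ π : Equiv.Perm (Fin n), permWeight α π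

/-- Euclidean space `ℝ^d`. -/
abbrev Eu (d : ℕ) := EuclideanSpace ℝ (Fin d)

/-- The dual lattice point `z/L ∈ Λ* = L⁻¹ℤ^d`, for `z ∈ ℤ^d`. -/
def dualPt (d : ℕ) (L : ℝ) (z : Fin d → ℤ) : Eu d :=
  (WithLp.equiv 2 (Fin d → ℝ)).symm (fun i => (z i) / L)

/-- The critical density `ρ_c = ∑_{j≥1} e^{-α_j} ∫_{ℝ^d} e^{-jε(k)} dk`. -/
def rhoC (d : ℕ) (ε : Eu d → ℝ) (α : ℕ → ℝ) : ℝ :=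
  ∑' j : ℕ, Real.exp (-α (j+1)) * ∫ k : Eu d, Real.exp (-(((j:ℝ)+1) * ε k))

/-- The finite-volume critical density
`ρ_c^{(Λ)} = ∑_{j≥1} e^{-α_j} |Λ|⁻¹ ∑_{k∈Λ*, k≠0} e^{-jε(k)}`. -/
def rhoCL (d : ℕ) (ε : Eu d → ℝ) (α : ℕ → ℝ) (L : ℝ) : ℝ :=
  ∑' j : ℕ, Real.exp (-α (j+1)) *
    ((L ^ d)⁻¹ * ∑' z : Fin d → ℤ,
      if z = 0 then 0 else Real.exp (-(((j:ℝ)+1) * ε (dualPt d L z))))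

/-- The unnormalized weight `∏_{k∈Λ*} e^{-ε(k)n_k} h_{n_k}` of a configuration of
occupation numbers (the product reduces to the support of `n` since `h_0 = 1`). -/
def fmW (d : ℕ) (ε : Eu d → ℝ) (α : ℕ → ℝ) (L : ℝ) (n : (Fin d → ℤ) →₀ ℕ) : ℝ≥0∞ :=
  ∏ k ∈ n.support,
    ENNReal.ofReal (Real.exp (-(ε (dualPt d L k) * n k)) * hcoef α (n k))

/-- The probability, under the Fourier-mode measure on occupation numbers
`(n_k)_{k∈Λ*}` with `∑_k n_k = N`, of the event `A`. -/
def fmP (d : ℕ) (ε : Eu d → ℝ) (α : ℕ → ℝ) (L : ℝ) (N : ℕ)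
    (A : ((Fin d → ℤ) →₀ ℕ) → Prop) : ℝ≥0∞ :=
  (∑' n : (Fin d → ℤ) →₀ ℕ,
      if (n.sum fun _ m => m) = N ∧ A n then fmW d ε α L n else 0) /
    (∑' n : (Fin d → ℤ) →₀ ℕ,
      if (n.sum fun _ m => m) = N then fmW d ε α L n else 0)

/-- Splitting off the value at `a` of a finitely supported function. -/
theorem tsum_finsupp_split {ι : Type*} (a : ι) (F : (ι →₀ ℕ) → ℝ≥0∞) :
    ∑' n, F n = ∑' m : ℕ, ∑' n : ι →₀ ℕ, if n a = 0 then F (n + Finsupp.single a m) else 0 := by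
  have key : ∀ n : ι →₀ ℕ, F n = ∑' m : ℕ, if n a = m then F n else 0 := fun n => by
    rw [tsum_eq_single (n a)]
    · simp
    · intro m hm; simp [hm.symm]
  rw [tsum_congr key, ENNReal.tsum_comm]
  refine tsum_congr fun m => ?_
  have hinj : Function.Injective fun n : ι →₀ ℕ => n + Finsupp.single a m :=
    add_left_injective _
  rw [← hinj.tsum_eq (f := fun n => if n a = m then F n else 0)]
  · refine tsum_congr fun n => ?_
    simp
  · intro n hn
    have h : n a = m := by by_contra h; simp [h] at hn
    refine ⟨n - Finsupp.single a m, ?_⟩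
    ext i
    by_cases hi : i = a
    · subst hi; simp [h]
    · simp [Ne.symm hi]

theorem Finsupp.prod_add_single_of_eq_zero {ι : Type*} (g : ι → ℕ → ℝ≥0∞) (hg : ∀ k, g k 0 = 1)
    (a : ι) (n : ι →₀ ℕ) (h : n a = 0) (m : ℕ) :
    (n + Finsupp.single a m).prod g = g a m * n.prod g := by
  have h1 : ((n + Finsupp.single a m).erase a) = n := by
    rw [Finsupp.erase_add, Finsupp.erase_single, add_zero, Finsupp.erase_of_notMem_support]
    simpa using h
  by_cases hm : m = 0
  · simp [hm, hg]
  · rw [← Finsupp.mul_prod_erase (n + Finsupp.single a m) a g (by simp [hm]), h1]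
    simp [h]

theorem tsum_finsupp_prod_finset {ι : Type*} (g : ι → ℕ → ℝ≥0∞) (hg : ∀ k, g k 0 = 1)
    (S : Finset ι) :
    (∑' n : ι →₀ ℕ, if n.support ⊆ S then n.prod g else 0) = ∏ k ∈ S, ∑' n, g k n := by
  induction S using Finset.induction_on with
  | empty =>
    rw [tsum_eq_single 0]
    · simp
    · intro n hn; simp [hn]
  | insert a S ha ih =>
    rw [tsum_finsupp_split a, Finset.prod_insert ha, ← ih, ← ENNReal.tsum_mul_right]
    refine tsum_congr fun m => ?_
    rw [← ENNReal.tsum_mul_left]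
    refine tsum_congr fun n => ?_
    by_cases h : n a = 0
    · have hs : (n + Finsupp.single a m).support ⊆ insert a S ↔ n.support ⊆ S := by
        constructor
        · intro hh i hi
          have hia : i ≠ a := by rintro rfl; simp [h] at hi
          have := hh (show i ∈ (n + Finsupp.single a m).support by
            simp at hi ⊢; intro h0; exact absurd h0 hi)
          exact (Finset.mem_insert.1 this).resolve_left hia
        · intro hh i hi
          by_cases hia : i = a
          · simp [hia]
          · refine Finset.mem_insert_of_mem (hh ?_)
            simpa [Finsupp.single_apply, Ne.symm hia] using hi
      simp only [h, if_true, hs, Finsupp.prod_add_single_of_eq_zero g hg a n h m]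
      split_ifs <;> simp
    · have : ¬ n.support ⊆ S := fun hh => ha (hh (by simpa using h))
      simp [h, this]

/-- A sum over occupation numbers of a product weight is the product of the single-mode sums,
here expressed through exponentials. -/
theorem tsum_finsupp_prod_exp {ι : Type*} (g : ι → ℕ → ℝ≥0∞) (hg : ∀ k, g k 0 = 1)
    (b : ι → ℝ) (hb : ∀ k, 0 ≤ b k) (hbs : Summable b)
    (hgb : ∀ k, ∑' n, g k n = ENNReal.ofReal (Real.exp (b k))) :
    ∑' n : ι →₀ ℕ, n.prod g = ENNReal.ofReal (Real.exp (∑' k, b k)) := by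
  have hS : ∀ S : Finset ι, (∑' n : ι →₀ ℕ, if n.support ⊆ S then n.prod g else 0) =
      ENNReal.ofReal (Real.exp (∑ k ∈ S, b k)) := fun S => by
    rw [tsum_finsupp_prod_finset g hg S, Real.exp_sum,
      ENNReal.ofReal_prod_of_nonneg fun _ _ => (Real.exp_pos _).le]
    exact Finset.prod_congr rfl fun k _ => hgb k
  apply le_antisymm
  · rw [ENNReal.tsum_eq_iSup_sum]
    refine iSup_le fun t => ?_
    calc ∑ n ∈ t, n.prod g
        = ∑ n ∈ t, if n.support ⊆ t.biUnion Finsupp.support then n.prod g else 0 :=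
          Finset.sum_congr rfl fun n hn => by
            rw [if_pos (Finset.subset_biUnion_of_mem Finsupp.support hn)]
      _ ≤ _ := ENNReal.sum_le_tsum t
      _ = _ := hS _
      _ ≤ _ := ENNReal.ofReal_le_ofReal
          (Real.exp_le_exp.2 (hbs.sum_le_tsum _ fun k _ => hb k))
  · have h1 : Tendsto (fun S : Finset ι => ENNReal.ofReal (Real.exp (∑ k ∈ S, b k))) atTop
        (𝓝 (ENNReal.ofReal (Real.exp (∑' k, b k)))) :=
      (ENNReal.continuous_ofReal.comp Real.continuous_exp).continuousAt.tendsto.comp hbs.hasSum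
    refine le_of_tendsto' h1 fun S => ?_
    rw [← hS]
    exact ENNReal.tsum_le_tsum fun n => by split_ifs <;> simp

/-- The cycle counts of a permutation, as a finitely supported function of the cycle length. -/
def cycFinsupp {n : ℕ} (π : Equiv.Perm (Fin n)) : ℕ →₀ ℕ :=
  Multiset.toFinsupp (π.cycleType + Multiset.replicate (n - π.cycleType.sum) 1)

theorem cycleType_sum_le {n : ℕ} (π : Equiv.Perm (Fin n)) : π.cycleType.sum ≤ n := by
  simpa using π.sum_cycleType_le

theorem count_one_cycleType {n : ℕ} (π : Equiv.Perm (Fin n)) : π.cycleType.count 1 = 0 :=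
  Multiset.count_eq_zero.2 fun h => by
    have := Equiv.Perm.two_le_of_mem_cycleType h
    omega

theorem count_zero_cycleType {n : ℕ} (π : Equiv.Perm (Fin n)) : π.cycleType.count 0 = 0 :=
  Multiset.count_eq_zero.2 fun h => by
    have := Equiv.Perm.two_le_of_mem_cycleType h
    omega

theorem cycFinsupp_apply {n : ℕ} (π : Equiv.Perm (Fin n)) (j : ℕ) :
    cycFinsupp π j = cycCount π j := by
  unfold cycFinsupp cycCount
  rw [Multiset.toFinsupp_apply, Multiset.count_add, Multiset.count_replicate]
  split_ifs with h1 h2 h2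
  · subst h1; simp [count_one_cycleType]
  · exact absurd h1.symm h2
  · exact absurd h2.symm h1
  · simp

theorem cycFinsupp_zero {n : ℕ} (π : Equiv.Perm (Fin n)) : cycFinsupp π 0 = 0 := by
  rw [cycFinsupp_apply, cycCount, if_neg (by norm_num), count_zero_cycleType]

theorem sum_cycFinsupp {n : ℕ} (π : Equiv.Perm (Fin n)) :
    ((cycFinsupp π).sum fun j m => m * j) = n := by
  have := Finsupp.sum_toMultiset (cycFinsupp π)
  simp only [smul_eq_mul] at this
  rw [← this]
  simp [cycFinsupp, Multiset.sum_replicate, cycleType_sum_le]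

theorem cycFinsupp_eq_iff {n : ℕ} (π : Equiv.Perm (Fin n)) (r : ℕ →₀ ℕ) (h0 : r 0 = 0)
    (hr : (r.sum fun j m => m * j) = n) :
    cycFinsupp π = r ↔ π.cycleType = (Finsupp.toMultiset r).filter (2 ≤ ·) := by
  constructor
  · rintro rfl
    simp only [cycFinsupp, Multiset.toFinsupp_toMultiset, Multiset.filter_add]
    rw [Multiset.filter_eq_self.2 fun _ => Equiv.Perm.two_le_of_mem_cycleType,
      Multiset.filter_eq_nil.2, add_zero]
    intro a ha
    rw [Multiset.eq_of_mem_replicate ha]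
    norm_num
  · intro h
    have hc : ∀ j, 2 ≤ j → cycFinsupp π j = r j := fun j hj => by
      rw [cycFinsupp_apply, cycCount, if_neg (by omega), h, Multiset.count_filter_of_pos hj,
        Finsupp.count_toMultiset]
    have hs := (sum_cycFinsupp π).trans hr.symm
    have e : ∀ q : ℕ →₀ ℕ, (q.sum fun j m => m * j) =
        q 1 + ((q.erase 1).sum fun j m => m * j) := fun q => by
      by_cases hq : 1 ∈ q.support
      · rw [← Finsupp.add_sum_erase _ _ _ hq, mul_one]
      · rw [Finsupp.erase_of_notMem_support hq, Finsupp.notMem_support_iff.1 hq, zero_add]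
    have hE : (cycFinsupp π).erase 1 = r.erase 1 := by
      ext j
      by_cases h1 : j = 1
      · simp [h1]
      rw [Finsupp.erase_ne h1, Finsupp.erase_ne h1]
      rcases Nat.eq_zero_or_pos j with rfl | hj
      · rw [h0, cycFinsupp_zero]
      · exact hc j (by omega)
    ext j
    rcases Nat.lt_or_ge j 2 with hj | hj
    · interval_cases j
      · rw [h0, cycFinsupp_zero]
      · rw [e, e r, hE] at hs
        omega
    · exact hc j hj

theorem card_cycFinsupp_eq {n : ℕ} (r : ℕ →₀ ℕ) (h0 : r 0 = 0)
    (hr : (r.sum fun j m => m * j) = n) :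
    (Finset.univ.filter fun π : Equiv.Perm (Fin n) => cycFinsupp π = r).card *
      (r.prod fun j m => j ^ m * m.factorial) = n.factorial := by
  have h := Equiv.Perm.card_of_cycleType_mul_eq (Fin n) ((Finsupp.toMultiset r).filter (2 ≤ ·))
  have hone : (Finsupp.toMultiset r).filter (¬ 2 ≤ ·) = Multiset.replicate (r 1) 1 := by
    ext j
    rw [Multiset.count_filter, Multiset.count_replicate, Finsupp.count_toMultiset]
    rcases Nat.lt_or_ge j 2 with hj | hj
    · interval_cases j <;> simp [h0]
    · have : (1 : ℕ) ≠ j := by omega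
      simp [hj, this]
  have hsplit := Multiset.filter_add_not (2 ≤ ·) (Finsupp.toMultiset r)
  rw [hone] at hsplit
  have hsum : ((Finsupp.toMultiset r).filter (2 ≤ ·)).sum + r 1 = n := by
    have := congrArg Multiset.sum hsplit
    rw [Finsupp.sum_toMultiset] at this
    simpa [Multiset.sum_replicate, hr] using this
  have hprod : ((Finsupp.toMultiset r).filter (2 ≤ ·)).prod = r.prod fun j m => j ^ m := by
    have := congrArg Multiset.prod hsplit
    rw [Finsupp.prod_toMultiset] at this
    simpa using this
  have hfac : (r 1).factorial * ∏ j ∈ ((Finsupp.toMultiset r).filter (2 ≤ ·)).toFinset,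
      (((Finsupp.toMultiset r).filter (2 ≤ ·)).count j).factorial =
      r.prod fun _ m => m.factorial := by
    have h1 : ((Finsupp.toMultiset r).filter (2 ≤ ·)).toFinset = (r.erase 1).support := by
      ext j
      simp only [Multiset.mem_toFinset, Multiset.mem_filter, Finsupp.mem_toMultiset,
        Finsupp.support_erase, Finset.mem_erase]
      constructor
      · rintro ⟨a, b⟩; exact ⟨by omega, a⟩
      · rintro ⟨a, b⟩
        refine ⟨b, ?_⟩
        rcases Nat.eq_zero_or_pos j with rfl | hj
        · simp [h0] at b
        · omega
    have h2 : (r.prod fun _ m => m.factorial) =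
        (r 1).factorial * (r.erase 1).prod fun _ m => m.factorial := by
      by_cases hq : 1 ∈ r.support
      · rw [← Finsupp.mul_prod_erase _ _ _ hq]
      · rw [Finsupp.erase_of_notMem_support hq, Finsupp.notMem_support_iff.1 hq]; simp
    rw [h1, h2, Finsupp.prod]
    congr 1
    refine Finset.prod_congr rfl fun j hj => ?_
    have hj' := hj
    rw [← h1, Multiset.mem_toFinset, Multiset.mem_filter] at hj
    rw [Multiset.count_filter_of_pos hj.2, Finsupp.count_toMultiset, Finsupp.erase_ne]
    rintro rfl
    simp at hj'
  rw [if_pos ⟨by simp; omega, fun a ha => (Multiset.mem_filter.1 ha).2⟩, Fintype.card_fin,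
    show n - ((Finsupp.toMultiset r).filter (2 ≤ ·)).sum = r 1 by omega, mul_assoc,
    mul_left_comm (r 1).factorial, hfac, hprod, ← Finsupp.prod_mul] at h
  rw [← h]
  congr 2
  ext π
  simp [cycFinsupp_eq_iff π r h0 hr]

theorem permWeight_eq {n : ℕ} (α : ℕ → ℝ) (π : Equiv.Perm (Fin n)) :
    permWeight α π = (cycFinsupp π).prod fun j m => Real.exp (-α j) ^ m := by
  unfold permWeight
  have : ∑ j ∈ Finset.Icc 1 n, α j * (cycCount π j : ℝ) =
      (cycFinsupp π).sum fun j m => α j * m := by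
    rw [Finsupp.sum_of_support_subset _ (s := Finset.Icc 1 n) _ _ (by simp)]
    · simp [cycFinsupp_apply]
    · intro j hj
      rw [Finset.mem_Icc]
      constructor
      · rcases Nat.eq_zero_or_pos j with rfl | h
        · simp [cycFinsupp_zero] at hj
        · exact h
      · have h1 := Finset.single_le_sum (f := fun j => cycFinsupp π j * j)
          (fun _ _ => Nat.zero_le _) hj
        have h2 := sum_cycFinsupp π
        rw [Finsupp.sum] at h2
        have h3 : 1 ≤ cycFinsupp π j := Nat.one_le_iff_ne_zero.2 (by simpa using hj)
        simp only [h2] at h1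
        nlinarith
  rw [this, Finsupp.sum, Finsupp.prod, ← Finset.sum_neg_distrib, Real.exp_sum]
  refine Finset.prod_congr rfl fun j _ => ?_
  rw [← Real.exp_nat_mul]
  ring_nf

/-- The weight of `m` cycles of length `j`. -/
def cycWeight (α : ℕ → ℝ) (j m : ℕ) : ℝ := (Real.exp (-α j) / j) ^ m / m.factorial

theorem cycWeight_nonneg (α : ℕ → ℝ) (j m : ℕ) : 0 ≤ cycWeight α j m := by
  unfold cycWeight; positivity

theorem ofReal_hcoef (α : ℕ → ℝ) (n : ℕ) :
    ENNReal.ofReal (hcoef α n) = ∑' r : ℕ →₀ ℕ,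
      if (r.sum fun j m => m * j) = n then
        r.prod fun j m => ENNReal.ofReal (cycWeight α j m) else 0 := by
  have hw : ∀ π : Equiv.Perm (Fin n), 0 ≤ permWeight α π := fun π => (Real.exp_pos _).le
  have hnf : (0 : ℝ) < n.factorial := by exact_mod_cast n.factorial_pos
  rw [hcoef, Finset.mul_sum,
    ENNReal.ofReal_sum_of_nonneg fun π _ => mul_nonneg (inv_nonneg.2 hnf.le) (hw π)]
  have key : ∀ π : Equiv.Perm (Fin n), ENNReal.ofReal ((n.factorial : ℝ)⁻¹ * permWeight α π) =
      ∑' r : ℕ →₀ ℕ, if cycFinsupp π = r then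
        ENNReal.ofReal ((n.factorial : ℝ)⁻¹ * r.prod fun j m => Real.exp (-α j) ^ m) else 0 := by
    intro π
    rw [tsum_eq_single (cycFinsupp π)]
    · rw [if_pos rfl, permWeight_eq]
    · intro r hr; rw [if_neg hr.symm]
  rw [Finset.sum_congr rfl fun π _ => key π,
    ← Summable.tsum_finsetSum fun _ _ => ENNReal.summable]
  refine tsum_congr fun r => ?_
  rw [← Finset.sum_filter, Finset.sum_const, nsmul_eq_mul]
  by_cases h : (r.sum fun j m => m * j) = n
  · rw [if_pos h]
    by_cases h0 : r 0 = 0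
    · have hc := card_cycFinsupp_eq r h0 h
      rw [Finsupp.prod, Finsupp.prod,
        ← ENNReal.ofReal_prod_of_nonneg fun _ _ => cycWeight_nonneg _ _ _,
        ← ENNReal.ofReal_natCast, ← ENNReal.ofReal_mul (by positivity)]
      congr 1
      have hcR : ((Finset.univ.filter fun π : Equiv.Perm (Fin n) => cycFinsupp π = r).card : ℝ) *
          ∏ j ∈ r.support, ((j : ℝ) ^ r j * (r j).factorial) = n.factorial := by
        rw [← hc, Finsupp.prod]; push_cast; rfl
      have hne : ∏ j ∈ r.support, ((j : ℝ) ^ r j * (r j).factorial) ≠ 0 := by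
        intro h; rw [h, mul_zero] at hcR; exact hnf.ne hcR
      have hsp : ∏ j ∈ r.support, cycWeight α j (r j) =
          (∏ j ∈ r.support, Real.exp (-α j) ^ r j) /
            ∏ j ∈ r.support, ((j : ℝ) ^ r j * (r j).factorial) := by
        rw [← Finset.prod_div_distrib]
        refine Finset.prod_congr rfl fun j _ => ?_
        rw [cycWeight, div_pow, div_div]
      rw [hsp, ← hcR]
      have hc0 : ((Finset.univ.filter fun π : Equiv.Perm (Fin n) => cycFinsupp π = r).card : ℝ)
          ≠ 0 := by
        intro h; rw [h, zero_mul] at hcR; exact hnf.ne hcR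
      field_simp
    · rw [Finset.filter_eq_empty_iff.2, Finset.card_empty, Nat.cast_zero, zero_mul]
      · symm
        refine Finset.prod_eq_zero (i := 0) (by simpa using h0) ?_
        simp [cycWeight, h0]
      · rintro π - rfl
        exact h0 (cycFinsupp_zero π)
  · rw [if_neg h, Finset.filter_eq_empty_iff.2, Finset.card_empty, Nat.cast_zero, zero_mul]
    rintro π - rfl
    exact h (sum_cycFinsupp π)

/-- The generating function `∑_{j≥1} j⁻¹ e^{-α_j} x^j` of the cycle weights. -/
def cycSeries (α : ℕ → ℝ) (x : ℝ) : ℝ :=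
  ∑' j : ℕ, Real.exp (-α (j + 1)) / ((j : ℝ) + 1) * x ^ (j + 1)

theorem cycSeries_zero (α : ℕ → ℝ) : cycSeries α 0 = 0 := by
  simp [cycSeries]

theorem summable_cycSeries {α : ℕ → ℝ} {C x : ℝ} (hC : ∀ j : ℕ, 1 ≤ j → Real.exp (-α j) ≤ C)
    (hx0 : 0 ≤ x) (hx1 : x < 1) :
    Summable fun j : ℕ => Real.exp (-α (j + 1)) / ((j : ℝ) + 1) * x ^ (j + 1) := by
  refine Summable.of_nonneg_of_le (fun j => by positivity) (fun j => ?_)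
    (((summable_nat_add_iff 1).2 (summable_geometric_of_lt_one hx0 hx1)).mul_left C)
  refine mul_le_mul_of_nonneg_right ((div_le_self (Real.exp_pos _).le ?_).trans (hC _ (by omega)))
    (by positivity)
  have : (0 : ℝ) ≤ j := Nat.cast_nonneg j
  linarith

theorem cycSeries_nonneg (α : ℕ → ℝ) {x : ℝ} (hx0 : 0 ≤ x) : 0 ≤ cycSeries α x :=
  tsum_nonneg fun j => by positivity

theorem abs_pow_succ_sub_pow_succ_le {s t : ℝ} (hs : s ∈ Set.Icc (0 : ℝ) 1)
    (ht : t ∈ Set.Icc (0 : ℝ) 1) (j : ℕ) :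
    |t ^ (j + 1) - s ^ (j + 1)| ≤ ((j : ℝ) + 1) * |t - s| := by
  induction j with
  | zero => simp
  | succ j ih =>
    have e : t ^ (j + 1 + 1) - s ^ (j + 1 + 1) =
        t * (t ^ (j + 1) - s ^ (j + 1)) + s ^ (j + 1) * (t - s) := by ring
    rw [e]
    refine (abs_add_le _ _).trans ?_
    rw [abs_mul, abs_mul, abs_of_nonneg ht.1, abs_of_nonneg (pow_nonneg hs.1 _)]
    have h1 : s ^ (j + 1) ≤ 1 := pow_le_one₀ hs.1 hs.2
    have h2 := mul_le_mul ht.2 ih (abs_nonneg _) zero_le_one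
    have h3 := mul_le_mul_of_nonneg_right h1 (abs_nonneg (t - s))
    push_cast
    linarith

theorem abs_cycSeries_sub_le {α : ℕ → ℝ} {C x : ℝ}
    (hC : ∀ j : ℕ, 1 ≤ j → Real.exp (-α j) ≤ C) (hx0 : 0 ≤ x) (hx1 : x < 1) {s t : ℝ}
    (hs : s ∈ Set.Icc (0 : ℝ) 1) (ht : t ∈ Set.Icc (0 : ℝ) 1) :
    |cycSeries α (x * t) - cycSeries α (x * s)| ≤ C * (1 - x)⁻¹ * |t - s| := by
  have hlt : ∀ u ∈ Set.Icc (0 : ℝ) 1, x * u < 1 := fun u hu =>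
    (mul_le_of_le_one_right hx0 hu.2).trans_lt hx1
  have hSt := summable_cycSeries hC (mul_nonneg hx0 ht.1) (hlt t ht)
  have hSs := summable_cycSeries hC (mul_nonneg hx0 hs.1) (hlt s hs)
  have hC0 : 0 ≤ C := (Real.exp_pos _).le.trans (hC 1 le_rfl)
  rw [cycSeries, cycSeries, ← hSt.tsum_sub hSs, ← Real.norm_eq_abs]
  have hG : HasSum (fun j : ℕ => C * x ^ j * |t - s|) (C * (1 - x)⁻¹ * |t - s|) :=
    ((hasSum_geometric_of_lt_one hx0 hx1).mul_left C).mul_right _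
  refine tsum_of_norm_bounded hG fun j => ?_
  have e : Real.exp (-α (j + 1)) / ((j : ℝ) + 1) * (x * t) ^ (j + 1) -
      Real.exp (-α (j + 1)) / ((j : ℝ) + 1) * (x * s) ^ (j + 1) =
      Real.exp (-α (j + 1)) / ((j : ℝ) + 1) * x ^ (j + 1) * (t ^ (j + 1) - s ^ (j + 1)) := by
    ring
  rw [e, Real.norm_eq_abs, abs_mul, abs_of_nonneg (by positivity)]
  calc _ ≤ Real.exp (-α (j + 1)) / ((j : ℝ) + 1) * x ^ (j + 1) * (((j : ℝ) + 1) * |t - s|) :=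
        mul_le_mul_of_nonneg_left (abs_pow_succ_sub_pow_succ_le hs ht j) (by positivity)
    _ = Real.exp (-α (j + 1)) * x ^ (j + 1) * |t - s| := by
        have : (j : ℝ) + 1 ≠ 0 := by positivity
        field_simp
    _ ≤ C * x ^ j * |t - s| := by
        refine mul_le_mul_of_nonneg_right (mul_le_mul (hC _ (by omega)) ?_ (by positivity) hC0)
          (abs_nonneg _)
        exact pow_le_pow_of_le_one hx0 hx1.le (Nat.le_succ j)

theorem hcoef_nonneg (α : ℕ → ℝ) (n : ℕ) : 0 ≤ hcoef α n :=
  mul_nonneg (by positivity) (Finset.sum_nonneg fun _ _ => (Real.exp_pos _).le)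

theorem hcoef_zero (α : ℕ → ℝ) : hcoef α 0 = 1 := by
  simp [hcoef, permWeight]

theorem tsum_ofReal_pow_div_factorial {b : ℝ} (hb : 0 ≤ b) :
    ∑' m : ℕ, ENNReal.ofReal (b ^ m / m.factorial) = ENNReal.ofReal (Real.exp b) := by
  rw [← ENNReal.ofReal_tsum_of_nonneg (fun m => by positivity) (Real.summable_pow_div_factorial b),
    Real.exp_eq_exp_ℝ, NormedSpace.exp_eq_tsum_div]

/-- The exponential formula: `∑_n h_n x^n = exp(∑_{j≥1} j⁻¹ e^{-α_j} x^j)`. -/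
theorem tsum_hcoef_mul_pow {α : ℕ → ℝ} {C x : ℝ}
    (hC : ∀ j : ℕ, 1 ≤ j → Real.exp (-α j) ≤ C) (hx0 : 0 ≤ x) (hx1 : x < 1) :
    ∑' n : ℕ, ENNReal.ofReal (x ^ n * hcoef α n) =
      ENNReal.ofReal (Real.exp (cycSeries α x)) := by
  have hb : ∀ j : ℕ, 0 ≤ Real.exp (-α j) / j * x ^ j := fun j => by positivity
  have hsum : Summable fun j : ℕ => Real.exp (-α j) / j * x ^ j := by
    rw [← summable_nat_add_iff 1]
    simpa using summable_cycSeries hC hx0 hx1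
  have hser : ∑' j : ℕ, Real.exp (-α j) / j * x ^ j = cycSeries α x := by
    rw [hsum.tsum_eq_zero_add, cycSeries]
    simp
  rw [← hser, ← tsum_finsupp_prod_exp
    (fun j m => ENNReal.ofReal ((Real.exp (-α j) / j * x ^ j) ^ m / m.factorial))
    (fun k => by simp) _ hb hsum fun k => tsum_ofReal_pow_div_factorial (hb k)]
  simp only [ENNReal.ofReal_mul (pow_nonneg hx0 _), ofReal_hcoef, ← ENNReal.tsum_mul_left]
  rw [ENNReal.tsum_comm]
  refine tsum_congr fun r => ?_
  rw [tsum_eq_single (r.sum fun j m => m * j)]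
  · rw [if_pos rfl, Finsupp.sum, ← Finset.prod_pow_eq_pow_sum,
      ENNReal.ofReal_prod_of_nonneg fun _ _ => pow_nonneg hx0 _, Finsupp.prod, Finsupp.prod,
      ← Finset.prod_mul_distrib]
    refine Finset.prod_congr rfl fun j _ => ?_
    rw [← ENNReal.ofReal_mul (pow_nonneg hx0 _), cycWeight, mul_pow, ← pow_mul, mul_comm j]
    congr 1
    ring
  · intro n hn
    rw [if_neg hn.symm, mul_zero]

theorem hcoef_le {α : ℕ → ℝ} {C x : ℝ}
    (hC : ∀ j : ℕ, 1 ≤ j → Real.exp (-α j) ≤ C) (hx0 : 0 ≤ x) (hx1 : x < 1) (n : ℕ) :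
    x ^ n * hcoef α n ≤ Real.exp (cycSeries α x) := by
  rw [← ENNReal.ofReal_le_ofReal_iff (Real.exp_pos _).le, ← tsum_hcoef_mul_pow hC hx0 hx1]
  exact ENNReal.le_tsum n

theorem le_hcoef (α : ℕ → ℝ) (n : ℕ) : Real.exp (-α n) / n ≤ hcoef α n := by
  rw [← ENNReal.ofReal_le_ofReal_iff (hcoef_nonneg α n), ofReal_hcoef]
  refine le_trans (le_of_eq ?_) (ENNReal.le_tsum (Finsupp.single n 1))
  rw [if_pos (by simp), Finsupp.prod_single_index (by simp [cycWeight])]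
  simp [cycWeight]

theorem hcoef_pos (α : ℕ → ℝ) (n : ℕ) : 0 < hcoef α n := by
  rcases Nat.eq_zero_or_pos n with rfl | h
  · simp [hcoef_zero]
  · exact lt_of_lt_of_le (by positivity) (le_hcoef α n)

/-- The grand canonical partition function of independent modes with fugacities `u k`. -/
theorem tsum_modes {ι : Type*} {α : ℕ → ℝ} {C x : ℝ}
    (hC : ∀ j : ℕ, 1 ≤ j → Real.exp (-α j) ≤ C) (hx0 : 0 ≤ x) (hx1 : x < 1) (u : ι → ℝ)
    (hu : ∀ k, u k ∈ Set.Icc (0 : ℝ) 1) (hus : Summable u) :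
    ∑' n : ι →₀ ℕ, ENNReal.ofReal (x ^ (n.sum fun _ m => m)) *
        n.prod (fun k m => ENNReal.ofReal (u k ^ m * hcoef α m)) =
      ENNReal.ofReal (Real.exp (∑' k, cycSeries α (x * u k))) := by
  have hlt : ∀ k, x * u k < 1 := fun k => (mul_le_of_le_one_right hx0 (hu k).2).trans_lt hx1
  have hnn : ∀ k, 0 ≤ x * u k := fun k => mul_nonneg hx0 (hu k).1
  have hs : Summable fun k => cycSeries α (x * u k) := by
    refine Summable.of_nonneg_of_le (fun k => cycSeries_nonneg α (hnn k)) (fun k => ?_)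
      (hus.mul_left (C * (1 - x)⁻¹))
    have := abs_cycSeries_sub_le hC hx0 hx1 (s := 0) (by simp) (hu k)
    rw [mul_zero, cycSeries_zero, sub_zero, sub_zero, abs_of_nonneg (hu k).1] at this
    exact (le_abs_self _).trans this
  rw [← tsum_finsupp_prod_exp (fun k m => ENNReal.ofReal ((x * u k) ^ m * hcoef α m))
    (fun k => by simp [hcoef_zero]) _ (fun k => cycSeries_nonneg α (hnn k)) hs
    fun k => tsum_hcoef_mul_pow hC (hnn k) (hlt k)]
  refine tsum_congr fun n => ?_
  rw [Finsupp.sum, ← Finset.prod_pow_eq_pow_sum,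
      ENNReal.ofReal_prod_of_nonneg fun _ _ => pow_nonneg hx0 _, Finsupp.prod, Finsupp.prod,
      ← Finset.prod_mul_distrib]
  refine Finset.prod_congr rfl fun j _ => ?_
  rw [← ENNReal.ofReal_mul (pow_nonneg hx0 _), mul_pow, mul_assoc]

/-- The index of the cell of the lattice `L⁻¹ℤ^d` containing a point. -/
def cellIdx (d : ℕ) (L : ℝ) (k : Eu d) : Fin d → ℤ := fun i => ⌊L * k i⌋

theorem measurable_cellIdx (d : ℕ) (L : ℝ) : Measurable (cellIdx d L) := by
  refine measurable_pi_lambda _ fun i => Int.measurable_floor.comp ?_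
  exact (measurable_const.mul (by fun_prop))

theorem volume_cellIdx_preimage (d : ℕ) {L : ℝ} (hL : 0 < L) (z : Fin d → ℤ) :
    volume (cellIdx d L ⁻¹' {z}) = ENNReal.ofReal (L ^ d)⁻¹ := by
  have h : cellIdx d L ⁻¹' {z} = WithLp.ofLp ⁻¹'
      (Set.univ.pi fun i => Set.Ico ((z i : ℝ) / L) (((z i : ℝ) + 1) / L)) := by
    ext k
    simp only [cellIdx, Set.mem_preimage, Set.mem_singleton_iff, funext_iff, Int.floor_eq_iff,
      Set.mem_pi, Set.mem_univ, true_imp_iff, Set.mem_Ico, div_le_iff₀ hL, lt_div_iff₀ hL,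
      mul_comm L]
  rw [h, (PiLp.volume_preserving_ofLp (Fin d)).measure_preimage
    (MeasurableSet.univ_pi fun i => measurableSet_Ico).nullMeasurableSet, Real.volume_pi_Ico,
    ← ENNReal.ofReal_prod_of_nonneg]
  · congr 1
    rw [Finset.prod_congr rfl fun i _ => show ((z i : ℝ) + 1) / L - (z i : ℝ) / L = L⁻¹ by ring]
    simp
  · intro i _
    rw [← sub_div]
    have : (0 : ℝ) ≤ L⁻¹ := by positivity
    simpa using this

theorem lintegral_cellIdx (d : ℕ) {L : ℝ} (hL : 0 < L) (F : (Fin d → ℤ) → ℝ≥0∞) :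
    ∫⁻ k, F (cellIdx d L k) = ENNReal.ofReal (L ^ d)⁻¹ * ∑' z, F z := by
  rw [← lintegral_map (f := F) Measurable.of_discrete (measurable_cellIdx d L), lintegral_countable',
    ← ENNReal.tsum_mul_left]
  refine tsum_congr fun z => ?_
  rw [Measure.map_apply (measurable_cellIdx d L) (measurableSet_singleton z),
    volume_cellIdx_preimage d hL, mul_comm]

theorem integral_cellIdx (d : ℕ) {L : ℝ} (hL : 0 < L) (G : (Fin d → ℤ) → ℝ) (hG : ∀ z, 0 ≤ G z) :
    ∫ k, G (cellIdx d L k) = (L ^ d)⁻¹ * ∑' z, G z := by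
  rw [integral_eq_lintegral_of_nonneg_ae (Eventually.of_forall fun k => hG _)
    ((Measurable.of_discrete (f := G)).comp (measurable_cellIdx d L)).aestronglyMeasurable,
    lintegral_cellIdx d hL fun z => ENNReal.ofReal (G z), ENNReal.toReal_mul,
    ENNReal.tsum_toReal_eq fun _ => ENNReal.ofReal_ne_top,
    ENNReal.toReal_ofReal (by positivity)]
  exact congrArg _ (tsum_congr fun z => ENNReal.toReal_ofReal (hG z))

theorem tendsto_dualPt_cellIdx (d : ℕ) {Ls : ℕ → ℝ} (hLs : Tendsto Ls atTop atTop) (k : Eu d) :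
    Tendsto (fun m => dualPt d (Ls m) (cellIdx d (Ls m) k)) atTop (𝓝 k) := by
  have h : Tendsto (fun m => fun i => ((cellIdx d (Ls m) k i : ℤ) : ℝ) / Ls m) atTop
      (𝓝 (WithLp.ofLp k)) := by
    rw [tendsto_pi_nhds]
    intro i
    have h1 : Tendsto (fun m => k i - (Ls m)⁻¹) atTop (𝓝 (k i)) := by
      simpa using (tendsto_inv_atTop_zero.comp hLs).const_sub (k i)
    refine tendsto_of_tendsto_of_tendsto_of_le_of_le' h1 tendsto_const_nhds ?_ ?_
    · filter_upwards [hLs.eventually_gt_atTop 0] with m hm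
      rw [le_div_iff₀ hm, sub_mul, inv_mul_cancel₀ hm.ne', mul_comm]
      exact (Int.sub_one_lt_floor _).le
    · filter_upwards [hLs.eventually_gt_atTop 0] with m hm
      rw [div_le_iff₀ hm, mul_comm]
      exact Int.floor_le _
  exact ((PiLp.continuous_toLp 2 _).tendsto _).comp h

theorem tsum_dualPt_tendsto_top (d : ℕ) {f : Eu d → ℝ} (hf : Continuous f) (hf0 : ∀ k, 0 ≤ f k)
    (hfi : ¬ Integrable f) {Ls : ℕ → ℝ} (hLs : Tendsto Ls atTop atTop) :
    Tendsto (fun m => ENNReal.ofReal (Ls m ^ d)⁻¹ * ∑' z, ENNReal.ofReal (f (dualPt d (Ls m) z)))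
      atTop (𝓝 ∞) := by
  have htop : ∫⁻ k, ENNReal.ofReal (f k) = ∞ := by
    by_contra h
    refine hfi ⟨hf.aestronglyMeasurable, ?_⟩
    rw [hasFiniteIntegral_iff_ofReal (Eventually.of_forall hf0)]
    exact lt_top_iff_ne_top.2 h
  have hfat := lintegral_liminf_le (μ := (volume : Measure (Eu d))) (u := atTop)
    (f := fun m k => ENNReal.ofReal (f (dualPt d (Ls m) (cellIdx d (Ls m) k))))
    fun m => (Measurable.of_discrete (f := fun z => ENNReal.ofReal (f (dualPt d (Ls m) z)))).comp
      (measurable_cellIdx d (Ls m))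
  have hlim : ∀ k, liminf (fun m => ENNReal.ofReal (f (dualPt d (Ls m) (cellIdx d (Ls m) k))))
      atTop = ENNReal.ofReal (f k) := fun k =>
    Tendsto.liminf_eq ((ENNReal.continuous_ofReal.tendsto _).comp
      ((hf.tendsto k).comp (tendsto_dualPt_cellIdx d hLs k)))
  rw [lintegral_congr hlim, htop, top_le_iff] at hfat
  have hT := tendsto_of_le_liminf_of_limsup_le (a := (∞ : ℝ≥0∞)) hfat.ge le_top
  refine hT.congr' ?_
  filter_upwards [hLs.eventually_gt_atTop 0] with m hm
  exact lintegral_cellIdx d hm fun z => ENNReal.ofReal (f (dualPt d (Ls m) z))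

/-- If a positive function has convergent Riemann sums but is not integrable (so that its Bochner
integral vanishes), then its lattice sums are eventually infinite. -/
theorem eventually_not_summable (d : ℕ) {f : Eu d → ℝ} (hf : Continuous f) (hf0 : ∀ k, 0 ≤ f k)
    (hfi : ¬ Integrable f) {Ls : ℕ → ℝ} (hLs : Tendsto Ls atTop atTop)
    (hR : Tendsto (fun m => (Ls m ^ d)⁻¹ * ∑' z, f (dualPt d (Ls m) z)) atTop (𝓝 (∫ k, f k))) :
    ∀ᶠ m in atTop, ¬ Summable fun z => f (dualPt d (Ls m) z) := by
  rw [integral_undef hfi] at hR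
  filter_upwards [(tsum_dualPt_tendsto_top d hf hf0 hfi hLs).eventually_const_lt
    ENNReal.one_lt_top, hR.eventually_lt_const one_pos, hLs.eventually_gt_atTop 0]
    with m h1 h2 hm hs
  rw [← ENNReal.ofReal_tsum_of_nonneg (fun z => hf0 _) hs,
    ← ENNReal.ofReal_mul (by positivity), ← ENNReal.ofReal_one,
    ENNReal.ofReal_lt_ofReal_iff_of_nonneg zero_le_one] at h1
  exact lt_asymm h1 h2

theorem eventually_summable (d : ℕ) {f : Eu d → ℝ} (hf : Continuous f) (hf0 : ∀ k, 0 < f k)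
    (hfi : Integrable f) {Ls : ℕ → ℝ}
    (hR : Tendsto (fun m => (Ls m ^ d)⁻¹ * ∑' z, f (dualPt d (Ls m) z)) atTop (𝓝 (∫ k, f k))) :
    ∀ᶠ m in atTop, Summable fun z => f (dualPt d (Ls m) z) := by
  have hpos : 0 < ∫ k, f k :=
    integral_pos_of_integrable_nonneg_nonzero (x := 0) hf hfi (fun k => (hf0 k).le) (hf0 0).ne'
  filter_upwards [hR.eventually_const_lt hpos] with m hm
  by_contra h
  rw [tsum_eq_zero_of_not_summable h, mul_zero] at hm
  exact lt_irrefl _ hm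

/-- Convergence of the Riemann sums of `f ≥ 0` implies that of `Φ ∘ f` for `Φ` Lipschitz with
`Φ 0 = 0`. -/
theorem tendsto_riemann_comp (d : ℕ) {f : Eu d → ℝ} (hf : Continuous f)
    (hf01 : ∀ k, f k ∈ Set.Icc (0 : ℝ) 1) (hfi : Integrable f) {Ls : ℕ → ℝ}
    (hLs : Tendsto Ls atTop atTop)
    (hsum : ∀ᶠ m in atTop, Summable fun z => f (dualPt d (Ls m) z))
    (hR : Tendsto (fun m => (Ls m ^ d)⁻¹ * ∑' z, f (dualPt d (Ls m) z)) atTop (𝓝 (∫ k, f k)))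
    {Φ : ℝ → ℝ} {K : ℝ} (hΦ0 : Φ 0 = 0) (hΦ : ∀ t ∈ Set.Icc (0 : ℝ) 1, 0 ≤ Φ t)
    (hK : ∀ s ∈ Set.Icc (0 : ℝ) 1, ∀ t ∈ Set.Icc (0 : ℝ) 1, |Φ t - Φ s| ≤ K * |t - s|) :
    Tendsto (fun m => (Ls m ^ d)⁻¹ * ∑' z, Φ (f (dualPt d (Ls m) z))) atTop
      (𝓝 (∫ k, Φ (f k))) := by
  set F : ℕ → Eu d → ℝ := fun m k => f (dualPt d (Ls m) (cellIdx d (Ls m) k))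
  have hmeas : ∀ (H : ℝ → ℝ) (m : ℕ), AEStronglyMeasurable (fun k => H (F m k)) volume :=
    fun H m => ((Measurable.of_discrete (f := fun z => H (f (dualPt d (Ls m) z)))).comp
      (measurable_cellIdx d (Ls m))).aestronglyMeasurable
  have hFlim : ∀ k, Tendsto (fun m => F m k) atTop (𝓝 (f k)) := fun k =>
    (hf.tendsto k).comp (tendsto_dualPt_cellIdx d hLs k)
  have hFint : ∀ᶠ m in atTop, Integrable (F m) := by
    filter_upwards [hsum, hLs.eventually_gt_atTop 0] with m hm hL
    refine ⟨hmeas id m, ?_⟩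
    rw [hasFiniteIntegral_iff_ofReal (Eventually.of_forall fun k => (hf01 _).1),
      lintegral_cellIdx d hL fun z => ENNReal.ofReal (f (dualPt d (Ls m) z)),
      ← ENNReal.ofReal_tsum_of_nonneg (fun z => (hf01 _).1) hm, ← ENNReal.ofReal_mul (by positivity)]
    exact ENNReal.ofReal_lt_top
  have hFI : Tendsto (fun m => ∫ k, F m k) atTop (𝓝 (∫ k, f k)) := by
    refine hR.congr' ?_
    filter_upwards [hLs.eventually_gt_atTop 0] with m hL
    exact (integral_cellIdx d hL (fun z => f (dualPt d (Ls m) z)) fun z => (hf01 _).1).symm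
  have hmin : Tendsto (fun m => ∫ k, min (f k) (F m k)) atTop (𝓝 (∫ k, f k)) := by
    refine tendsto_integral_of_dominated_convergence f (fun m => ?_) hfi (fun m => ?_) ?_
    · exact hf.aestronglyMeasurable.inf (hmeas id m)
    · refine Eventually.of_forall fun k => ?_
      rw [Real.norm_eq_abs, abs_of_nonneg (le_min (hf01 _).1 (hf01 _).1)]
      exact min_le_left _ _
    · refine Eventually.of_forall fun k => ?_
      simpa using (tendsto_const_nhds (x := f k)).min (hFlim k)
  have hL1 : Tendsto (fun m => K * ∫ k, |F m k - f k|) atTop (𝓝 0) := by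
    have h := ((hFI.add_const (∫ k, f k)).sub (hmin.const_mul 2)).const_mul K
    rw [show K * ((∫ k, f k) + (∫ k, f k) - 2 * ∫ k, f k) = 0 by ring] at h
    refine h.congr' ?_
    filter_upwards [hFint] with m hm
    have hmi : Integrable fun k => min (f k) (F m k) := hfi.inf hm
    have hadd : Integrable fun k => F m k + f k := hm.add hfi
    rw [← integral_const_mul 2, ← integral_add hm hfi, ← integral_sub hadd (hmi.const_mul 2)]
    congr 1
    refine integral_congr_ae (Eventually.of_forall fun k => ?_)
    beta_reduce
    rcases le_total (f k) (F m k) with h | h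
    · rw [min_eq_left h, abs_of_nonneg (sub_nonneg.2 h)]; ring
    · rw [min_eq_right h, abs_of_nonpos (sub_nonpos.2 h)]; ring
  have hΦcont : ContinuousOn Φ (Set.Icc 0 1) :=
    (LipschitzOnWith.of_dist_le_mul (K := K.toNNReal) fun t ht s hs =>
      (hK s hs t ht).trans (mul_le_mul_of_nonneg_right (Real.le_coe_toNNReal K)
        (abs_nonneg _))).continuousOn
  have hΦle : ∀ t ∈ Set.Icc (0 : ℝ) 1, ‖Φ t‖ ≤ ‖K * t‖ := fun t ht => by
    have := hK 0 (by simp) t ht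
    rw [hΦ0, sub_zero, sub_zero, abs_of_nonneg ht.1] at this
    exact this.trans (le_abs_self _)
  have hΦf : Integrable fun k => Φ (f k) :=
    (hfi.const_mul K).mono (hΦcont.comp_continuous hf hf01).aestronglyMeasurable
      (Eventually.of_forall fun k => hΦle _ (hf01 k))
  rw [tendsto_iff_norm_sub_tendsto_zero]
  refine squeeze_zero' (Eventually.of_forall fun _ => norm_nonneg _) ?_ hL1
  filter_upwards [hFint, hLs.eventually_gt_atTop 0] with m hm hL
  have hΦF : Integrable fun k => Φ (F m k) :=
    (hm.const_mul K).mono (hmeas Φ m) (Eventually.of_forall fun k => hΦle _ (hf01 _))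
  rw [← integral_cellIdx d hL (fun z => Φ (f (dualPt d (Ls m) z))) fun z => hΦ _ (hf01 _),
    ← integral_sub hΦF hΦf, ← integral_const_mul]
  refine norm_integral_le_of_norm_le ((hm.sub hfi).abs.const_mul K)
    (Eventually.of_forall fun k => ?_)
  exact hK _ (hf01 _) _ (hf01 _)

theorem pow_sub_pow_le_mul_log {x y : ℝ} (hx : 0 < x) (hy : 0 < y) (n : ℕ) :
    y ^ n - x ^ n ≤ n * Real.log (y / x) * y ^ n := by
  have h := Real.log_le_sub_one_of_pos (show 0 < (x / y) ^ n by positivity)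
  rw [Real.log_pow, ← inv_div y x, Real.log_inv, inv_div] at h
  have h2 := mul_le_mul_of_nonneg_right h (show 0 ≤ y ^ n by positivity)
  have e : (x / y) ^ n * y ^ n = x ^ n := by rw [← mul_pow, div_mul_cancel₀ _ hy.ne']
  rw [sub_mul, e] at h2
  linarith

theorem summable_mul_pow_succ {w : ℕ → ℝ} (hw : ∀ j, 0 ≤ w j) (hws : Summable w) {x : ℝ}
    (hx0 : 0 ≤ x) (hx1 : x ≤ 1) : Summable fun j : ℕ => w j * x ^ (j + 1) :=
  Summable.of_nonneg_of_le (fun j => mul_nonneg (hw j) (pow_nonneg hx0 _))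
    (fun j => mul_le_of_le_one_right (hw j) (pow_le_one₀ hx0 hx1)) hws

theorem summable_div_mul_pow_succ {w : ℕ → ℝ} (hw : ∀ j, 0 ≤ w j) (hws : Summable w) {x : ℝ}
    (hx0 : 0 ≤ x) (hx1 : x ≤ 1) : Summable fun j : ℕ => w j / ((j : ℝ) + 1) * x ^ (j + 1) :=
  summable_mul_pow_succ (fun j => div_nonneg (hw j) (by positivity))
    (hws.of_nonneg_of_le (fun j => div_nonneg (hw j) (by positivity)) fun j =>
      div_le_self (hw j) (by have : (0 : ℝ) ≤ j := Nat.cast_nonneg j; linarith)) hx0 hx1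

theorem tsum_div_mul_pow_sub_le {w : ℕ → ℝ} (hw : ∀ j, 0 ≤ w j) (hws : Summable w) {x y : ℝ}
    (hx0 : 0 < x) (hx1 : x ≤ 1) (hy0 : 0 < y) (hy1 : y ≤ 1) :
    (∑' j : ℕ, w j / ((j : ℝ) + 1) * y ^ (j + 1)) - (∑' j : ℕ, w j / ((j : ℝ) + 1) * x ^ (j + 1)) ≤
      Real.log (y / x) * ∑' j : ℕ, w j * y ^ (j + 1) := by
  have hsy := summable_div_mul_pow_succ hw hws hy0.le hy1
  have hsx := summable_div_mul_pow_succ hw hws hx0.le hx1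
  rw [← hsy.tsum_sub hsx, ← tsum_mul_left]
  refine (hsy.sub hsx).tsum_le_tsum (fun j => ?_)
    ((summable_mul_pow_succ hw hws hy0.le hy1).mul_left _)
  have h := mul_le_mul_of_nonneg_left (pow_sub_pow_le_mul_log hx0 hy0 (j + 1))
    (div_nonneg (hw j) (show (0 : ℝ) ≤ (j : ℝ) + 1 by positivity))
  rw [mul_sub] at h
  refine h.trans (le_of_eq ?_)
  have : (j : ℝ) + 1 ≠ 0 := by positivity
  push_cast
  field_simp

theorem continuousOn_tsum_mul_pow {w : ℕ → ℝ} (hw : ∀ j, 0 ≤ w j) (hws : Summable w) :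
    ContinuousOn (fun x : ℝ => ∑' j : ℕ, w j * x ^ (j + 1)) (Set.Icc 0 1) := by
  refine continuousOn_tsum (fun j => by fun_prop) hws fun j x hx => ?_
  rw [Real.norm_eq_abs, abs_of_nonneg (mul_nonneg (hw j) (pow_nonneg hx.1 _))]
  exact mul_le_of_le_one_right (hw j) (pow_le_one₀ hx.1 hx.2)

/-- Below the critical density there are three fugacities for which the Chernoff bounds are
effective: the density of the grand canonical state at the middle one lies in
`((1 - κ) ρ, ρ)`. -/
theorem exists_fugacities {w : ℕ → ℝ} (hw : ∀ j, 0 ≤ w j) (hws : Summable w) {ρ κ : ℝ}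
    (hρ : 0 < ρ) (hρw : ρ ≤ ∑' j, w j) (hκ0 : 0 < κ) (hκ1 : κ < 1) :
    ∃ x₀ x x₁ : ℝ, 0 < x₀ ∧ x₀ < x ∧ x < x₁ ∧ x₁ < 1 ∧
      (∑' j : ℕ, w j / ((j : ℝ) + 1) * x₁ ^ (j + 1)) -
        (∑' j : ℕ, w j / ((j : ℝ) + 1) * x ^ (j + 1)) < ρ * Real.log (x₁ / x) ∧
      (∑' j : ℕ, w j / ((j : ℝ) + 1) * x₀ ^ (j + 1)) -
        (∑' j : ℕ, w j / ((j : ℝ) + 1) * x ^ (j + 1)) < -((1 - κ) * ρ * Real.log (x / x₀)) := by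
  set R : ℝ → ℝ := fun x => ∑' j : ℕ, w j * x ^ (j + 1) with hR
  have hR0 : R 0 = 0 := by simp [hR]
  have hR1 : R 1 = ∑' j, w j := by simp [hR]
  have hmono : ∀ x y, 0 ≤ x → x ≤ y → y ≤ 1 → R x ≤ R y := fun x y hx hxy hy =>
    (summable_mul_pow_succ hw hws hx (hxy.trans hy)).tsum_le_tsum
      (fun j => mul_le_mul_of_nonneg_left (pow_le_pow_left₀ hx hxy _) (hw j))
      (summable_mul_pow_succ hw hws (hx.trans hxy) hy)
  have hivt := intermediate_value_Icc zero_le_one (continuousOn_tsum_mul_pow hw hws)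
  change Set.Icc (R 0) (R 1) ⊆ R '' Set.Icc 0 1 at hivt
  rw [hR0, hR1] at hivt
  have hκρ : 0 < κ * ρ := mul_pos hκ0 hρ
  have hκρ1 : κ * ρ < ρ := mul_lt_of_lt_one_left hρ hκ1
  obtain ⟨x₀, hx₀, hRx₀⟩ := hivt (show ρ - 2 / 3 * (κ * ρ) ∈ _ from ⟨by linarith, by linarith⟩)
  obtain ⟨x₁, hx₁, hRx₁⟩ := hivt (show ρ - 1 / 3 * (κ * ρ) ∈ _ from ⟨by linarith, by linarith⟩)
  have h01 : x₀ < x₁ := by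
    by_contra! h
    have := hmono x₁ x₀ hx₁.1 h hx₀.2
    linarith
  have h0 : 0 < x₀ := by
    rcases hx₀.1.eq_or_lt with h | h
    · rw [← h, hR0] at hRx₀; linarith
    · exact h
  have h1 : x₁ < 1 := by
    rcases hx₁.2.eq_or_lt with h | h
    · rw [h, hR1] at hRx₁; linarith
    · exact h
  obtain ⟨x, hx0, hx1⟩ := exists_between h01
  have hx : 0 < x := h0.trans hx0
  refine ⟨x₀, x, x₁, h0, hx0, hx1, h1, ?_, ?_⟩
  · refine (tsum_div_mul_pow_sub_le hw hws hx (hx1.trans h1).le (hx.trans hx1) h1.le).trans_lt ?_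
    have hlog : 0 < Real.log (x₁ / x) := Real.log_pos ((one_lt_div hx).2 hx1)
    rw [mul_comm]
    refine mul_lt_mul_of_pos_right ?_ hlog
    change R x₁ < ρ
    linarith
  · refine (tsum_div_mul_pow_sub_le hw hws hx (hx1.trans h1).le h0 hx₀.2).trans_lt ?_
    have hlog : 0 < Real.log (x / x₀) := Real.log_pos ((one_lt_div h0).2 hx0)
    rw [← inv_div x x₀, Real.log_inv, neg_mul, neg_lt_neg_iff, mul_comm]
    refine mul_lt_mul_of_pos_left ?_ hlog
    change (1 - κ) * ρ < R x₀
    linarith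

theorem integral_cycSeries {X : Type*} [MeasurableSpace X] {μ : Measure X} {α : ℕ → ℝ} {C x : ℝ}
    (hC : ∀ j : ℕ, 1 ≤ j → Real.exp (-α j) ≤ C) (hx0 : 0 ≤ x) (hx1 : x < 1) {f : X → ℝ}
    (hf : ∀ k, f k ∈ Set.Icc (0 : ℝ) 1) (hfi : Integrable f μ) :
    ∫ k, cycSeries α (x * f k) ∂μ =
      ∑' j : ℕ, (Real.exp (-α (j + 1)) * ∫ k, f k ^ (j + 1) ∂μ) / ((j : ℝ) + 1) * x ^ (j + 1) := by
  have hpi : ∀ j : ℕ, Integrable (fun k => f k ^ (j + 1)) μ := fun j =>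
    hfi.mono (hfi.1.pow _) (Eventually.of_forall fun k => by
      rw [Real.norm_eq_abs, Real.norm_eq_abs, abs_of_nonneg (hf k).1,
        abs_of_nonneg (pow_nonneg (hf k).1 _)]
      exact pow_le_of_le_one (hf k).1 (hf k).2 (Nat.succ_ne_zero j))
  have hle : ∀ j : ℕ, ∫ k, f k ^ (j + 1) ∂μ ≤ ∫ k, f k ∂μ := fun j =>
    integral_mono (hpi j) hfi fun k => pow_le_of_le_one (hf k).1 (hf k).2 (Nat.succ_ne_zero j)
  have e : ∀ (j : ℕ) (k : X), Real.exp (-α (j + 1)) / ((j : ℝ) + 1) * (x * f k) ^ (j + 1) =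
      Real.exp (-α (j + 1)) / ((j : ℝ) + 1) * x ^ (j + 1) * f k ^ (j + 1) := fun j k => by
    rw [mul_pow, mul_assoc]
  have hsum : Summable fun j : ℕ => ∫ k,
      ‖Real.exp (-α (j + 1)) / ((j : ℝ) + 1) * x ^ (j + 1) * f k ^ (j + 1)‖ ∂μ := by
    refine Summable.of_nonneg_of_le (fun j => integral_nonneg fun k => norm_nonneg _) (fun j => ?_)
      ((summable_cycSeries hC hx0 hx1).mul_right (∫ k, f k ∂μ))
    simp only [norm_mul]
    rw [integral_const_mul, ← norm_mul, Real.norm_eq_abs, abs_of_nonneg (by positivity)]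
    refine mul_le_mul_of_nonneg_left ?_ (by positivity)
    refine le_trans (le_of_eq (integral_congr_ae (Eventually.of_forall fun k => ?_))) (hle j)
    exact Real.norm_of_nonneg (pow_nonneg (hf k).1 _)
  simp only [cycSeries, e]
  rw [← integral_tsum_of_summable_integral_norm (fun j => (hpi j).const_mul _) hsum]
  refine tsum_congr fun j => ?_
  rw [integral_const_mul]
  ring

/-- Chernoff bounds: if the grand canonical partition functions at `x₀ < x < x₁` are suitably
related, at least half of the weight at `x` sits in `θ N < T ≤ N`. -/
theorem half_le_tsum_window {Ω : Type*} (W : Ω → ℝ≥0∞) (T : Ω → ℕ) {x₀ x x₁ B₀ B B₁ θ : ℝ} {N : ℕ}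
    (h0 : 0 < x₀) (h0x : x₀ < x) (hx1 : x < x₁)
    (hB₀ : ∑' n, ENNReal.ofReal (x₀ ^ T n) * W n = ENNReal.ofReal (Real.exp B₀))
    (hB : ∑' n, ENNReal.ofReal (x ^ T n) * W n = ENNReal.ofReal (Real.exp B))
    (hB₁ : ∑' n, ENNReal.ofReal (x₁ ^ T n) * W n = ENNReal.ofReal (Real.exp B₁))
    (hhigh : B₁ - B ≤ N * Real.log (x₁ / x) - Real.log 4)
    (hlow : B₀ - B ≤ -(θ * N * Real.log (x / x₀)) - Real.log 4) :
    ENNReal.ofReal (Real.exp B / 2) ≤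
      ∑' n, if θ * N < T n ∧ T n ≤ N then ENNReal.ofReal (x ^ T n) * W n else 0 := by
  have hx : 0 < x := h0.trans h0x
  have hx₁ : 0 < x₁ := hx.trans hx1
  have hl0 : 0 < Real.log (x / x₀) := Real.log_pos ((one_lt_div h0).2 h0x)
  have hl1 : 0 < Real.log (x₁ / x) := Real.log_pos ((one_lt_div hx).2 hx1)
  have hpow : ∀ {y : ℝ}, 0 < y → ∀ m : ℕ, y ^ m = Real.exp (m * Real.log y) := fun hy m => by
    rw [Real.exp_nat_mul, Real.exp_log hy]
  set c₀ := Real.exp (θ * N * Real.log (x / x₀))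
  set c₁ := Real.exp (-(N * Real.log (x₁ / x)))
  have hlogd : Real.log (x / x₀) = Real.log x - Real.log x₀ := Real.log_div hx.ne' h0.ne'
  have hlogd1 : Real.log (x₁ / x) = Real.log x₁ - Real.log x := Real.log_div hx₁.ne' hx.ne'
  have hpt : ∀ n, ENNReal.ofReal (x ^ T n) * W n ≤
      (if θ * N < T n ∧ T n ≤ N then ENNReal.ofReal (x ^ T n) * W n else 0) +
      (ENNReal.ofReal c₀ * (ENNReal.ofReal (x₀ ^ T n) * W n) +
        ENNReal.ofReal c₁ * (ENNReal.ofReal (x₁ ^ T n) * W n)) := fun n => by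
    by_cases hlo : θ * N < T n
    · by_cases hhi : T n ≤ N
      · rw [if_pos ⟨hlo, hhi⟩]
        exact le_self_add
      · refine le_trans ?_ (le_add_left (le_add_left le_rfl))
        rw [← mul_assoc, ← ENNReal.ofReal_mul (Real.exp_pos _).le]
        gcongr
        rw [hpow hx, hpow hx₁, ← Real.exp_add, Real.exp_le_exp]
        have hT : (N : ℝ) ≤ T n := by exact_mod_cast (not_le.1 hhi).le
        have := mul_le_mul_of_nonneg_right hT hl1.le
        rw [hlogd1] at this ⊢
        linarith
    · refine le_trans ?_ (le_add_left (le_add_right le_rfl))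
      rw [← mul_assoc, ← ENNReal.ofReal_mul (Real.exp_pos _).le]
      gcongr
      rw [hpow hx, hpow h0, ← Real.exp_add, Real.exp_le_exp]
      have := mul_le_mul_of_nonneg_right (not_lt.1 hlo) hl0.le
      rw [hlogd] at this ⊢
      linarith
  have hsum := ENNReal.tsum_le_tsum hpt
  rw [ENNReal.tsum_add, ENNReal.tsum_add, ENNReal.tsum_mul_left, ENNReal.tsum_mul_left, hB, hB₀,
    hB₁, ← ENNReal.ofReal_mul (Real.exp_pos _).le, ← ENNReal.ofReal_mul (Real.exp_pos _).le,
    ← ENNReal.ofReal_add (by positivity) (by positivity)] at hsum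
  have h4 : Real.exp (Real.log 4) = 4 := Real.exp_log (by norm_num)
  have hq : ∀ t, t ≤ B - Real.log 4 → Real.exp t ≤ Real.exp B / 4 := fun t ht => by
    rw [← h4, ← Real.exp_sub]
    exact Real.exp_le_exp.2 ht
  have htail : c₀ * Real.exp B₀ + c₁ * Real.exp B₁ ≤ Real.exp B / 2 := by
    have e0 : c₀ * Real.exp B₀ ≤ Real.exp B / 4 := by
      rw [← Real.exp_add]; exact hq _ (by linarith)
    have e1 : c₁ * Real.exp B₁ ≤ Real.exp B / 4 := by
      rw [← Real.exp_add]; exact hq _ (by linarith)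
    linarith
  have h2 : ENNReal.ofReal (Real.exp B / 2) + ENNReal.ofReal (Real.exp B / 2) =
      ENNReal.ofReal (Real.exp B) := by
    rw [← ENNReal.ofReal_add (by positivity) (by positivity), add_halves]
  rw [← h2] at hsum
  exact (ENNReal.add_le_add_iff_right ENNReal.ofReal_ne_top).1
    (hsum.trans (add_le_add le_rfl (ENNReal.ofReal_le_ofReal htail)))

/-- Summing out the occupation number of the mode `a` at fixed total occupation. -/
theorem tsum_fixed_total_split {ι : Type*} (a : ι) (g : ι → ℕ → ℝ≥0∞) (hg : ∀ k, g k 0 = 1)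
    (N : ℕ) (A : ℕ → Prop) :
    (∑' n : ι →₀ ℕ, if (n.sum fun _ m => m) = N ∧ A (n a) then n.prod g else 0) =
      ∑' n : ι →₀ ℕ, if n a = 0 ∧ (n.sum fun _ m => m) ≤ N ∧ A (N - n.sum fun _ m => m) then
        g a (N - n.sum fun _ m => m) * n.prod g else 0 := by
  rw [tsum_finsupp_split a, ENNReal.tsum_comm]
  refine tsum_congr fun n => ?_
  by_cases h : n a = 0
  · have hsum : ∀ m : ℕ, ((n + Finsupp.single a m).sum fun _ m => m) =
        (n.sum fun _ m => m) + m := fun m => by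
      rw [Finsupp.sum_add_index' (fun _ => rfl) (fun _ _ _ => rfl), Finsupp.sum_single_index rfl]
    simp only [h, if_true, hsum, Finsupp.prod_add_single_of_eq_zero g hg a n h, Finsupp.add_apply,
      Finsupp.single_eq_same, zero_add, true_and]
    rw [tsum_eq_single (N - n.sum fun _ m => m)]
    · have hN : (n.sum fun _ m => m) + (N - n.sum fun _ m => m) = N ↔ (n.sum fun _ m => m) ≤ N := by
        omega
      simp only [hN]
    · intro m hm
      rw [if_neg]
      intro hh
      omega
  · simp [h]

/-- The Fourier-mode weight of an event on `n_0`, written in terms of the nonzero modes. -/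
theorem tsum_fmW_split (d : ℕ) (ε : Eu d → ℝ) (α : ℕ → ℝ) (L : ℝ) (hε0 : ε 0 = 0) (N : ℕ)
    (A : ℕ → Prop) :
    (∑' n : (Fin d → ℤ) →₀ ℕ, if (n.sum fun _ m => m) = N ∧ A (n 0) then fmW d ε α L n else 0) =
      ∑' n : (Fin d → ℤ) →₀ ℕ, if (n.sum fun _ m => m) ≤ N ∧ A (N - n.sum fun _ m => m) then
        ENNReal.ofReal (hcoef α (N - n.sum fun _ m => m)) * n.prod (fun k m => ENNReal.ofReal
          ((if k = 0 then 0 else Real.exp (-ε (dualPt d L k))) ^ m * hcoef α m)) else 0 := by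
  have hd0 : dualPt d L 0 = 0 := by ext i; simp [dualPt]
  refine (tsum_fixed_total_split 0 (fun k m => ENNReal.ofReal
    (Real.exp (-(ε (dualPt d L k) * m)) * hcoef α m)) (fun k => by simp [hcoef_zero]) N A).trans ?_
  refine tsum_congr fun n => ?_
  by_cases h : n 0 = 0
  · have hprod : (n.prod fun k m => ENNReal.ofReal
        (Real.exp (-(ε (dualPt d L k) * m)) * hcoef α m)) = n.prod (fun k m => ENNReal.ofReal
          ((if k = 0 then 0 else Real.exp (-ε (dualPt d L k))) ^ m * hcoef α m)) := by
      refine Finset.prod_congr rfl fun k hk => ?_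
      have hk0 : k ≠ 0 := by rintro rfl; simp [h] at hk
      simp only [if_neg hk0, ← Real.exp_nat_mul]
      ring_nf
    simp only [h, true_and, hprod, hd0, hε0, zero_mul, neg_zero, Real.exp_zero, one_mul]
  · have hprod : n.prod (fun k m => ENNReal.ofReal
          ((if k = 0 then 0 else Real.exp (-ε (dualPt d L k))) ^ m * hcoef α m)) = 0 :=
      Finset.prod_eq_zero (i := 0) (by simpa using h) (by simp [h])
    rw [if_neg (fun hh => h hh.1), hprod, mul_zero, ite_self]

/-- The coefficients `h_k` decay at most subexponentially. -/
theorem exists_mul_pow_le_hcoef {α : ℕ → ℝ}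
    (hα : (∃ a : ℝ, Tendsto (fun j : ℕ => α j) atTop (𝓝 a)) ∨
      (∃ γ : ℝ, 0 < γ ∧ ∀ j : ℕ, 1 ≤ j → α j = γ * Real.log j))
    {s : ℝ} (hs0 : 0 < s) (hs1 : s < 1) : ∃ c > 0, ∀ k : ℕ, c * s ^ k ≤ hcoef α k := by
  have hev : ∀ᶠ k : ℕ in atTop, (k : ℝ) * s ^ k ≤ Real.exp (-α k) := by
    rcases hα with ⟨a, ha⟩ | ⟨γ, hγ, hγα⟩
    · have h1 : Tendsto (fun j : ℕ => Real.exp (-α j)) atTop (𝓝 (Real.exp (-a))) :=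
        (Real.continuous_exp.tendsto _).comp ha.neg
      filter_upwards [h1.eventually_const_lt (half_lt_self (Real.exp_pos (-a))),
        (tendsto_self_mul_const_pow_of_lt_one hs0.le hs1).eventually_lt_const
          (half_pos (Real.exp_pos (-a)))] with k h1 h2
      linarith
    · obtain ⟨p, hp⟩ := exists_nat_ge γ
      filter_upwards [(tendsto_pow_const_mul_const_pow_of_lt_one (p + 1) hs0.le
        hs1).eventually_lt_const one_pos, eventually_ge_atTop 1] with k h1 hk
      have hk1 : (1 : ℝ) ≤ k := by exact_mod_cast hk
      have hk0 : (0 : ℝ) < k := by linarith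
      have h2 : Real.exp (γ * Real.log k) ≤ (k : ℝ) ^ p := by
        rw [← Real.exp_log (pow_pos hk0 p), Real.log_pow, Real.exp_le_exp]
        exact mul_le_mul_of_nonneg_right hp (Real.log_nonneg hk1)
      rw [hγα k hk, Real.exp_neg, ← one_div, le_div_iff₀ (Real.exp_pos _)]
      calc (k : ℝ) * s ^ k * Real.exp (γ * Real.log k) ≤ (k : ℝ) * s ^ k * (k : ℝ) ^ p := by gcongr
        _ = (k : ℝ) ^ (p + 1) * s ^ k := by ring
        _ ≤ 1 := h1.le
  have hbdd : BddAbove (Set.range fun k : ℕ => s ^ k / hcoef α k) := by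
    refine IsBoundedUnder.bddAbove_range ⟨1, ?_⟩
    rw [eventually_map]
    filter_upwards [hev, eventually_ge_atTop 1] with k h1 hk
    have hk0 : (0 : ℝ) < k := by exact_mod_cast hk
    rw [div_le_one (hcoef_pos α k)]
    refine le_trans ?_ (le_hcoef α k)
    rw [le_div_iff₀ hk0]
    linarith
  obtain ⟨M, hM⟩ := hbdd
  refine ⟨(max M 1)⁻¹, by positivity, fun k => ?_⟩
  have h1 : s ^ k / hcoef α k ≤ max M 1 := (hM ⟨k, rfl⟩).trans (le_max_left _ _)
  rw [div_le_iff₀ (hcoef_pos α k)] at h1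
  rw [inv_mul_le_iff₀ (by positivity)]
  exact h1

/-- If a window of particle numbers close to `N` carries half of the grand canonical weight at
fugacity `exp (-l)`, a macroscopic deficit `N - T n` is exponentially unlikely. -/
theorem deficit_ratio_le {Ω : Type*} (W : Ω → ℝ≥0∞) (T : Ω → ℕ) {h : ℕ → ℝ}
    {l B κ δ σ c G : ℝ} {N : ℕ} (hN : 0 < N) (hl : 0 ≤ l) (hκδ : 2 * κ ≤ δ) (hσ : 0 ≤ σ)
    (hc : 0 < c) (hG : 0 ≤ G)
    (hlo : ∀ k : ℕ, c * Real.exp (-σ * k) ≤ h k) (hhi : ∀ k : ℕ, Real.exp (-σ * k) * h k ≤ G)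
    (hB : ∑' n, ENNReal.ofReal (Real.exp (-l) ^ T n) * W n = ENNReal.ofReal (Real.exp B))
    (hwin : ENNReal.ofReal (Real.exp B / 2) ≤ ∑' n, if (1 - κ) * N < T n ∧ T n ≤ N then
      ENNReal.ofReal (Real.exp (-l) ^ T n) * W n else 0) :
    (∑' n, if T n ≤ N ∧ δ < ((N - T n : ℕ) : ℝ) / N then ENNReal.ofReal (h (N - T n)) * W n else 0) /
      (∑' n, if T n ≤ N then ENNReal.ofReal (h (N - T n)) * W n else 0) ≤
      ENNReal.ofReal (2 * G / c * Real.exp ((2 * σ - l * κ) * N)) := by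
  have hN' : (0 : ℝ) < N := by exact_mod_cast hN
  have hpow : ∀ m : ℕ, Real.exp (-l) ^ m = Real.exp (-(l * m)) := fun m => by
    rw [← Real.exp_nat_mul]; ring_nf
  have hk : ∀ n, σ * ((N - T n : ℕ) : ℝ) ≤ σ * N := fun n =>
    mul_le_mul_of_nonneg_left (by exact_mod_cast Nat.sub_le _ _) hσ
  have hnum : (∑' n, if T n ≤ N ∧ δ < ((N - T n : ℕ) : ℝ) / N then
      ENNReal.ofReal (h (N - T n)) * W n else 0) ≤
      ENNReal.ofReal (G * Real.exp (σ * N + l * ((1 - 2 * κ) * N))) *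
        ENNReal.ofReal (Real.exp B) := by
    rw [← hB, ← ENNReal.tsum_mul_left]
    refine ENNReal.tsum_le_tsum fun n => ?_
    split_ifs with hn
    · rw [← mul_assoc, ← ENNReal.ofReal_mul (by positivity)]
      gcongr
      obtain ⟨h1, h2⟩ := hn
      rw [lt_div_iff₀ hN', Nat.cast_sub h1] at h2
      have h3 : (T n : ℝ) ≤ (1 - 2 * κ) * N := by
        have := mul_le_mul_of_nonneg_right hκδ hN'.le
        linarith
      have h4 := mul_le_mul_of_nonneg_left h3 hl
      have h5 := hhi (N - T n)
      rw [neg_mul, Real.exp_neg, inv_mul_le_iff₀ (Real.exp_pos _)] at h5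
      rw [hpow, mul_assoc, ← Real.exp_add, mul_comm G]
      refine h5.trans (mul_le_mul_of_nonneg_right (Real.exp_le_exp.2 ?_) hG)
      linarith [hk n]
    · simp
  have hden : ENNReal.ofReal (c * Real.exp (-(σ * N) + l * ((1 - κ) * N))) *
      ENNReal.ofReal (Real.exp B / 2) ≤
      ∑' n, if T n ≤ N then ENNReal.ofReal (h (N - T n)) * W n else 0 := by
    refine (mul_le_mul_right hwin _).trans ?_
    rw [← ENNReal.tsum_mul_left]
    refine ENNReal.tsum_le_tsum fun n => ?_
    split_ifs with h1 h2 h2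
    · rw [← mul_assoc, ← ENNReal.ofReal_mul (by positivity)]
      gcongr
      have h4 := mul_le_mul_of_nonneg_left h1.1.le hl
      rw [hpow, mul_assoc, ← Real.exp_add]
      refine le_trans (mul_le_mul_of_nonneg_left (Real.exp_le_exp.2 ?_) hc.le) (hlo _)
      linarith [hk n]
    · exact absurd h1.2 h2
    · simp
    · simp
  refine ENNReal.div_le_of_le_mul (hnum.trans (le_trans (le_of_eq ?_) (mul_le_mul_right hden _)))
  rw [← ENNReal.ofReal_mul (by positivity), ← ENNReal.ofReal_mul (by positivity),
    ← ENNReal.ofReal_mul (by positivity)]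
  congr 1
  have e : Real.exp (σ * N + l * ((1 - 2 * κ) * N)) = Real.exp ((2 * σ - l * κ) * N) *
      Real.exp (-(σ * N) + l * ((1 - κ) * N)) := by
    rw [← Real.exp_add]; ring_nf
  rw [e]
  field_simp

theorem tsum_fmW_eq_top (d : ℕ) (ε : Eu d → ℝ) (α : ℕ → ℝ) (L : ℝ) (hε0 : ε 0 = 0) {N : ℕ}
    (hN : 1 ≤ N) (hns : ¬ Summable fun z => Real.exp (-ε (dualPt d L z))) :
    (∑' n : (Fin d → ℤ) →₀ ℕ, if (n.sum fun _ m => m) = N then fmW d ε α L n else 0) = ⊤ := by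
  have hsplit := tsum_fmW_split d ε α L hε0 N fun _ => True
  simp only [and_true] at hsplit
  rw [hsplit]
  set u : (Fin d → ℤ) → ℝ := fun k => if k = 0 then 0 else Real.exp (-ε (dualPt d L k)) with hu
  have hu0 : ∀ k, 0 ≤ u k := fun k => by simp only [hu]; split_ifs <;> positivity
  have htop : ∑' k, ENNReal.ofReal (u k) = ⊤ := by
    by_contra hne
    have hus : Summable u :=
      (ENNReal.summable_toReal hne).congr fun k => ENNReal.toReal_ofReal (hu0 k)
    refine hns ((hus.update 0 (Real.exp (-ε (dualPt d L 0)))).congr fun k => ?_)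
    by_cases hk : k = 0
    · subst hk; simp
    · simp [hk, hu]
  have hinj : Function.Injective fun k : Fin d → ℤ => Finsupp.single k 1 :=
    Finsupp.single_left_injective one_ne_zero
  rw [eq_top_iff]
  refine le_trans (le_of_eq ?_) (ENNReal.tsum_comp_le_tsum_of_injective hinj _)
  have hterm : ∀ k : Fin d → ℤ, (if ((Finsupp.single k 1).sum fun _ m => m) ≤ N then
      ENNReal.ofReal (hcoef α (N - (Finsupp.single k 1).sum fun _ m => m)) *
        (Finsupp.single k 1).prod (fun k m => ENNReal.ofReal (u k ^ m * hcoef α m)) else 0) =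
      ENNReal.ofReal (hcoef α (N - 1)) * ENNReal.ofReal (hcoef α 1) * ENNReal.ofReal (u k) :=
    fun k => by
      rw [Finsupp.sum_single_index rfl, Finsupp.prod_single_index (by simp [hcoef_zero]),
        if_pos hN, pow_one, mul_comm (u k), ENNReal.ofReal_mul (hcoef_nonneg α 1), mul_assoc]
  rw [tsum_congr hterm, ENNReal.tsum_mul_left, htop, ENNReal.mul_top]
  simp [hcoef_pos]

theorem tendsto_logPartition (d : ℕ) (hd : 1 ≤ d) {ε : Eu d → ℝ} (hε0 : ε 0 = 0)
    (hε_nonneg : ∀ k, 0 ≤ ε k) (hf : Continuous fun k => Real.exp (-ε k))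
    (hfi : Integrable fun k => Real.exp (-ε k)) {α : ℕ → ℝ} {C : ℝ}
    (hC : ∀ j : ℕ, 1 ≤ j → Real.exp (-α j) ≤ C) {Ls : ℕ → ℝ} (hLs : Tendsto Ls atTop atTop)
    (hR : Tendsto (fun m => (Ls m ^ d)⁻¹ * ∑' z, Real.exp (-ε (dualPt d (Ls m) z))) atTop
      (𝓝 (∫ k, Real.exp (-ε k)))) {y : ℝ} (hy0 : 0 ≤ y) (hy1 : y < 1) :
    Tendsto (fun m => (Ls m ^ d)⁻¹ * ∑' k : Fin d → ℤ, cycSeries α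
      (y * if k = 0 then 0 else Real.exp (-ε (dualPt d (Ls m) k)))) atTop
      (𝓝 (∑' j : ℕ, (Real.exp (-α (j + 1)) * ∫ k, Real.exp (-ε k) ^ (j + 1)) / ((j : ℝ) + 1) *
        y ^ (j + 1))) := by
  have hf01 : ∀ k, Real.exp (-ε k) ∈ Set.Icc (0 : ℝ) 1 := fun k =>
    ⟨(Real.exp_pos _).le, Real.exp_le_one_iff.2 (neg_nonpos.2 (hε_nonneg k))⟩
  have hsum := eventually_summable d hf (fun k => Real.exp_pos _) hfi hR
  have h0 : cycSeries α (y * 0) = 0 := by rw [mul_zero, cycSeries_zero]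
  have hK := fun (s : ℝ) (hs : s ∈ Set.Icc (0 : ℝ) 1) (t : ℝ) (ht : t ∈ Set.Icc (0 : ℝ) 1) =>
    abs_cycSeries_sub_le hC hy0 hy1 hs ht
  have hmain := tendsto_riemann_comp d hf hf01 hfi hLs hsum hR (Φ := fun t => cycSeries α (y * t))
    h0 (fun t ht => cycSeries_nonneg α (mul_nonneg hy0 ht.1)) hK
  rw [integral_cycSeries hC hy0 hy1 hf01 hfi] at hmain
  have hV : Tendsto (fun m => (Ls m ^ d)⁻¹) atTop (𝓝 0) :=
    tendsto_inv_atTop_zero.comp ((tendsto_pow_atTop (by omega)).comp hLs)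
  have hlim := hmain.sub (hV.mul_const (cycSeries α y))
  rw [zero_mul, sub_zero] at hlim
  refine hlim.congr' ?_
  filter_upwards [hsum] with m hm
  have hs : Summable fun z => cycSeries α (y * Real.exp (-ε (dualPt d (Ls m) z))) := by
    refine Summable.of_nonneg_of_le
      (fun z => cycSeries_nonneg α (mul_nonneg hy0 (Real.exp_pos _).le)) (fun z => ?_)
      (hm.mul_left (C * (1 - y)⁻¹))
    have h := hK 0 (by simp) _ (hf01 (dualPt d (Ls m) z))
    rw [h0, sub_zero, sub_zero, abs_of_nonneg (hf01 _).1] at h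
    exact (le_abs_self _).trans h
  have hd0 : dualPt d (Ls m) 0 = 0 := by ext i; simp [dualPt]
  rw [hs.tsum_eq_add_tsum_ite 0, hd0, hε0, neg_zero, Real.exp_zero, mul_one, mul_add,
    add_sub_cancel_left]
  congr 1
  refine tsum_congr fun k => ?_
  by_cases hk : k = 0
  · simp [hk, cycSeries_zero]
  · simp [hk]

/-- Proposition 4.5: with cycle weights as in Theorem 2.1
(`α_j → α > 0` with `∑|α_j-α| < ∞`, or `α_j → α ≤ 0` with `∑ j⁻¹|α_j-α| < ∞`) or as in
Theorem 2.2 (`α_j = γ log j`, `γ > 0`), if `ρ ≤ ρ_c` then, under the Fourier-mode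
measure, in the thermodynamic limit `|Λ|, N → ∞` with `ρ = N/|Λ|` fixed,
`Prob(n_0/N > δ) → 0` for every `δ > 0`. -/
theorem statement14
    (d : ℕ) (hd : 1 ≤ d) (ε : Eu d → ℝ)
    -- assumptions on the dispersion relation `ε`
    (hε0 : ε 0 = 0) (hε_nonneg : ∀ k, 0 ≤ ε k) (hε_pos : ∀ k : Eu d, k ≠ 0 → 0 < ε k)
    (hε_uc : UniformContinuous fun k => Real.exp (-ε k))
    (hε_low : ∃ a > (0:ℝ), ∃ η : ℝ, 0 < η ∧ η < d ∧
      ∀ k : Eu d, ‖k‖ ≤ 1 → a * ‖k‖ ^ η ≤ ε k)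
    (hε_inf : ∀ δ : ℝ, 0 < δ → ∃ c > (0:ℝ), ∀ k : Eu d, δ ≤ ‖k‖ → c ≤ ε k)
    -- convergence of the Riemann sums `|Λ|⁻¹ ∑_{k∈Λ*} e^{-ε(k)} → ∫ e^{-ε(k)} dk`
    (hRiemann : Tendsto
      (fun L : ℝ => (L ^ d)⁻¹ * ∑' z : Fin d → ℤ, Real.exp (-ε (dualPt d L z)))
      atTop (𝓝 (∫ k : Eu d, Real.exp (-ε k))))
    -- bounded cycle weights: `sup_j e^{-α_j} < ∞`
    (α : ℕ → ℝ) (hα_bdd : ∃ C : ℝ, ∀ j : ℕ, 1 ≤ j → Real.exp (-α j) ≤ C)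
    -- cycle weights of one of the three admissible types
    (hα_case :
      (∃ αlim : ℝ, Tendsto (fun j : ℕ => α j) atTop (𝓝 αlim) ∧
        ((0 < αlim ∧ Summable fun j : ℕ => |α j - αlim|) ∨
         (αlim ≤ 0 ∧ Summable fun j : ℕ => |α j - αlim| / j))) ∨
      (∃ γ : ℝ, 0 < γ ∧ ∀ j : ℕ, 1 ≤ j → α j = γ * Real.log j))
    -- subcritical density and thermodynamic limit
    (ρ : ℝ) (hρ : 0 < ρ) (hρc : ρ ≤ rhoC d ε α)
    (Ls : ℕ → ℝ) (Ns : ℕ → ℕ) (hLs : Tendsto Ls atTop atTop)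
    (hfix : ∀ m, (Ns m : ℝ) = ρ * Ls m ^ d) :
    ∀ δ : ℝ, 0 < δ →
      Tendsto (fun m => fmP d ε α (Ls m) (Ns m)
        (fun n => δ < (n 0 : ℝ) / Ns m)) atTop (𝓝 0) := by
  intro δ hδ
  obtain ⟨C, hC⟩ := hα_bdd
  have hf : Continuous fun k => Real.exp (-ε k) := hε_uc.continuous
  have hR : Tendsto (fun m => (Ls m ^ d)⁻¹ * ∑' z, Real.exp (-ε (dualPt d (Ls m) z))) atTop
    (𝓝 (∫ k, Real.exp (-ε k))) := hRiemann.comp hLs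
  have hV : Tendsto (fun m => Ls m ^ d) atTop atTop := (tendsto_pow_atTop (by omega)).comp hLs
  have hV0 : ∀ᶠ m in atTop, 0 < Ls m ^ d := hV.eventually_gt_atTop 0
  have hN0 : ∀ᶠ m in atTop, 0 < Ns m := by
    filter_upwards [hV0] with m hm
    have h : (0 : ℝ) < Ns m := by rw [hfix]; positivity
    exact_mod_cast h
  by_cases hfi : Integrable fun k => Real.exp (-ε k)
  swap
  · refine tendsto_const_nhds.congr' ?_
    filter_upwards [eventually_not_summable d hf (fun k => (Real.exp_pos _).le) hfi hLs hR, hN0]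
      with m hm hN
    rw [fmP, tsum_fmW_eq_top d ε α (Ls m) hε0 hN hm, ENNReal.div_top]
  have hf01 : ∀ k, Real.exp (-ε k) ∈ Set.Icc (0 : ℝ) 1 := fun k =>
    ⟨(Real.exp_pos _).le, Real.exp_le_one_iff.2 (neg_nonpos.2 (hε_nonneg k))⟩
  set w : ℕ → ℝ := fun j => Real.exp (-α (j + 1)) * ∫ k, Real.exp (-ε k) ^ (j + 1) with hw
  have hρw : ρ ≤ ∑' j, w j := by
    refine hρc.trans (le_of_eq (tsum_congr fun j => ?_))
    simp only [hw, ← Real.exp_nat_mul]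
    congr 2
    ext k
    push_cast
    ring_nf
  have hw0 : ∀ j, 0 ≤ w j := fun j =>
    mul_nonneg (Real.exp_pos _).le (integral_nonneg fun k => pow_nonneg (hf01 k).1 _)
  have hws : Summable w := by
    by_contra h
    rw [tsum_eq_zero_of_not_summable h] at hρw
    linarith
  set κ := min δ 1 / 2 with hκ
  have hκ0 : 0 < κ := by positivity
  have hκ1 : κ < 1 := by have := min_le_right δ 1; linarith
  have hκδ : 2 * κ ≤ δ := by have := min_le_left δ 1; linarith
  obtain ⟨x₀, x, x₁, h0, h0x, hx1, h11, hhi, hlo⟩ := exists_fugacities hw0 hws hρ hρw hκ0 hκ1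
  have hx0 : 0 < x := h0.trans h0x
  have hx11 : x < 1 := hx1.trans h11
  set u : ℕ → (Fin d → ℤ) → ℝ := fun m k =>
    if k = 0 then 0 else Real.exp (-ε (dualPt d (Ls m) k)) with hu
  set B : ℝ → ℕ → ℝ := fun y m => ∑' k, cycSeries α (y * u m k)
  have hBlim : ∀ y, 0 ≤ y → y < 1 → Tendsto (fun m => (Ls m ^ d)⁻¹ * B y m) atTop
      (𝓝 (∑' j : ℕ, w j / ((j : ℝ) + 1) * y ^ (j + 1))) := fun y hy0 hy1 =>
    tendsto_logPartition d hd hε0 hε_nonneg hf hfi hC hLs hR hy0 hy1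
  have hlog4 : Tendsto (fun m => (Ls m ^ d)⁻¹ * Real.log 4) atTop (𝓝 0) := by
    simpa using (tendsto_inv_atTop_zero.comp hV).mul_const (Real.log 4)
  have hev1 : ∀ᶠ m in atTop, B x₁ m - B x m ≤ Ns m * Real.log (x₁ / x) - Real.log 4 := by
    have h := (((hBlim x₁ (hx0.trans hx1).le h11).sub (hBlim x hx0.le hx11)).add hlog4)
    rw [add_zero] at h
    filter_upwards [h.eventually_lt_const hhi, hV0] with m hm hm0
    rw [← mul_sub, ← mul_add, inv_mul_lt_iff₀ hm0] at hm
    rw [hfix]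
    linarith
  have hev0 : ∀ᶠ m in atTop,
      B x₀ m - B x m ≤ -((1 - κ) * Ns m * Real.log (x / x₀)) - Real.log 4 := by
    have h := (((hBlim x₀ h0.le (h0x.trans hx11)).sub (hBlim x hx0.le hx11)).add hlog4)
    rw [add_zero] at h
    filter_upwards [h.eventually_lt_const hlo, hV0] with m hm hm0
    rw [← mul_sub, ← mul_add, inv_mul_lt_iff₀ hm0] at hm
    rw [hfix]
    linarith
  set l := -Real.log x with hl
  have hl0 : 0 < l := neg_pos.2 (Real.log_neg hx0 hx11)
  have hxl : Real.exp (-l) = x := by rw [hl, neg_neg, Real.exp_log hx0]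
  set σ := l * κ / 4 with hσ
  have hlκ : 0 < l * κ := mul_pos hl0 hκ0
  have hσ0 : 0 < σ := by positivity
  have hs1 : Real.exp (-σ) < 1 := Real.exp_lt_one_iff.2 (neg_lt_zero.2 hσ0)
  have hexp : ∀ k : ℕ, Real.exp (-σ * k) = Real.exp (-σ) ^ k := fun k => by
    rw [← Real.exp_nat_mul, mul_comm]
  obtain ⟨c, hc, hcoef_lb⟩ := exists_mul_pow_le_hcoef
    (hα_case.imp_left fun ⟨a, ha, _⟩ => ⟨a, ha⟩) (Real.exp_pos (-σ)) hs1
  set G := Real.exp (cycSeries α (Real.exp (-σ)))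
  have hbound : ∀ᶠ m in atTop, fmP d ε α (Ls m) (Ns m) (fun n => δ < (n 0 : ℝ) / Ns m) ≤
      ENNReal.ofReal (2 * G / c * Real.exp ((2 * σ - l * κ) * Ns m)) := by
    filter_upwards [hev0, hev1, hN0, eventually_summable d hf (fun k => Real.exp_pos _) hfi hR]
      with m hm0 hm1 hN hsum
    have hu01 : ∀ k, u m k ∈ Set.Icc (0 : ℝ) 1 := fun k => by
      by_cases hk : k = 0
      · simp [hu, hk]
      · simpa [hu, hk] using hf01 (dualPt d (Ls m) k)
    have hus : Summable (u m) := hsum.of_nonneg_of_le (fun k => (hu01 k).1) fun k => by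
      by_cases hk : k = 0
      · simpa [hu, hk] using (Real.exp_pos _).le
      · simp [hu, hk]
    have hpart := fun (y : ℝ) (hy0 : 0 ≤ y) (hy1 : y < 1) => tsum_modes hC hy0 hy1 (u m) hu01 hus
    have hwin := half_le_tsum_window _ (fun n : (Fin d → ℤ) →₀ ℕ => n.sum fun _ m => m) h0 h0x hx1
      (hpart x₀ h0.le (h0x.trans hx11)) (hpart x hx0.le hx11) (hpart x₁ (hx0.trans hx1).le h11)
      hm1 hm0
    have hden := tsum_fmW_split d ε α (Ls m) hε0 (Ns m) fun _ => True
    simp only [and_true] at hden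
    rw [fmP, tsum_fmW_split d ε α (Ls m) hε0 (Ns m) fun j => δ < (j : ℝ) / Ns m, hden]
    refine deficit_ratio_le (B := B x m) _ (fun n : (Fin d → ℤ) →₀ ℕ => n.sum fun _ m => m) hN hl0.le
      hκδ hσ0.le hc (Real.exp_pos _).le (fun k => ?_) (fun k => ?_) ?_ ?_
    · rw [hexp]; exact hcoef_lb k
    · rw [hexp]; exact hcoef_le hC (Real.exp_pos _).le hs1 k
    · rw [hxl]; exact hpart x hx0.le hx11
    · rw [hxl]; exact hwin
  have hNtop : Tendsto (fun m => (Ns m : ℝ)) atTop atTop := by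
    simp only [hfix]
    exact hV.const_mul_atTop hρ
  have hneg : 2 * σ - l * κ < 0 := by rw [hσ]; linarith
  have hlim := ENNReal.tendsto_ofReal
    ((Real.tendsto_exp_atBot.comp (hNtop.const_mul_atTop_of_neg hneg)).const_mul (2 * G / c))
  rw [mul_zero, ENNReal.ofReal_zero] at hlim
  exact tendsto_of_tendsto_of_tendsto_of_le_of_le' tendsto_const_nhds hlim
    (Eventually.of_forall fun _ => bot_le) hbound
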